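/- (Completeness) For every ontology O, concept C, and label x: if the sequent ∅ ⊢ x : C is valid relative to O, then S(O) ⊩ ∅ ⊢ x : O̅, x : C. -/

import Mathlib

set_option maxHeartbeats 1000000

namespace RIQ

/-- Roles: role names and inverse roles. -/
inductive Role : Type
  | name : ℕ → Role
  | inv  : ℕ → Role
deriving DecidableEq

/-- The inverse of a role. -/
def Role.invert : Role → Role
  | .name r => .inv r
  | .inv r  => .name r

/-- RIQ concepts in negation normal form. -/
inductive Concept : Type
  | atom : ℕ → Concept
  | nneg : ℕ → Concept
  | inter : Concept → Concept → Concept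
  | union : Concept → Concept → Concept
  | ex : Role → Concept → Concept
  | all : Role → Concept → Concept
  | atMost : ℕ → Role → Concept → Concept
  | atLeast : ℕ → Role → Concept → Concept
deriving DecidableEq

/-- ⊤ := A₀ ⊔ ¬A₀ for the fixed concept name A₀ = 0. -/
def topC : Concept := .union (.atom 0) (.nneg 0)

/-- ⊥ := A₀ ⊓ ¬A₀ for the fixed concept name A₀ = 0. -/
def botC : Concept := .inter (.atom 0) (.nneg 0)

/-- NNF-negation. -/
def nnfNeg : Concept → Concept
  | .atom A => .nneg A
  | .nneg A => .atom A
  | .inter C D => .union (nnfNeg C) (nnfNeg D)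
  | .union C D => .inter (nnfNeg C) (nnfNeg D)
  | .ex r C => .all r (nnfNeg C)
  | .all r C => .ex r (nnfNeg C)
  | .atMost n r C => .atLeast (n+1) r C
  | .atLeast 0 _ _ => botC
  | .atLeast (n+1) r C => .atMost n r C

/-- Literals: concept names and their negations. -/
def IsLiteral : Concept → Prop
  | .atom _ => True
  | .nneg _ => True
  | _ => False

/-- A complex role inclusion axiom r₁ ∘ ⋯ ∘ rₙ ⊑ s. -/
structure RIA where
  lhs : List Role
  rhs : Role
deriving DecidableEq

/-- An ontology: a finite set of RIAs (RBox) together with a finite set of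
GCIs (TBox), each GCI ⊤ ⊑ C being recorded by its right-hand concept C. -/
structure Ontology where
  rias : Finset RIA
  gcis : Finset Concept

/-- Union of two ontologies. -/
def Ontology.union (O₁ O₂ : Ontology) : Ontology := ⟨O₁.rias ∪ O₂.rias, O₁.gcis ∪ O₂.gcis⟩

/-- Concept names occurring in a concept. -/
def cnames : Concept → Finset ℕ
  | .atom A => {A}
  | .nneg A => {A}
  | .inter C D => cnames C ∪ cnames D
  | .union C D => cnames C ∪ cnames D
  | .ex _ C => cnames C
  | .all _ C => cnames C
  | .atMost _ _ C => cnames C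
  | .atLeast _ _ C => cnames C

/-- Concept names occurring in an ontology. -/
def Ontology.cnames (O : Ontology) : Finset ℕ := O.gcis.sup RIQ.cnames

/-- An interpretation over the domain δ. -/
structure Interp (δ : Type) where
  cI : ℕ → Set δ
  rI : ℕ → Set (δ × δ)

/-- Interpretation of roles. -/
def Interp.roleI {δ : Type} (I : Interp δ) : Role → Set (δ × δ)
  | .name r => I.rI r
  | .inv r  => {p | (p.2, p.1) ∈ I.rI r}

/-- Relational composition of a list of roles (empty composition is the identity). -/
def Interp.listComp {δ : Type} (I : Interp δ) : List Role → Set (δ × δ)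
  | [] => {p | p.1 = p.2}
  | r :: rs => {p | ∃ b, (p.1, b) ∈ I.roleI r ∧ (b, p.2) ∈ I.listComp rs}

/-- Interpretation of concepts. -/
def Interp.cInterp {δ : Type} (I : Interp δ) : Concept → Set δ
  | .atom A => I.cI A
  | .nneg A => (I.cI A)ᶜ
  | .inter C D => I.cInterp C ∩ I.cInterp D
  | .union C D => I.cInterp C ∪ I.cInterp D
  | .ex r C => {a | ∃ b, (a, b) ∈ I.roleI r ∧ b ∈ I.cInterp C}
  | .all r C => {a | ∀ b, (a, b) ∈ I.roleI r → b ∈ I.cInterp C}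
  | .atMost n r C => {a | {b | (a, b) ∈ I.roleI r ∧ b ∈ I.cInterp C}.encard ≤ (n : ℕ∞)}
  | .atLeast n r C => {a | (n : ℕ∞) ≤ {b | (a, b) ∈ I.roleI r ∧ b ∈ I.cInterp C}.encard}

/-- I ⊨ O. -/
def Interp.models {δ : Type} (I : Interp δ) (O : Ontology) : Prop :=
  (∀ C ∈ O.gcis, I.cInterp topC ⊆ I.cInterp C) ∧
  (∀ ria ∈ O.rias, I.listComp ria.lhs ⊆ I.roleI ria.rhs)

/-- O ⊨ C ⊑ D. -/
def entails (O : Ontology) (C D : Concept) : Prop :=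
  ∀ (δ : Type) [Nonempty δ] (I : Interp δ), I.models O → I.cInterp C ⊆ I.cInterp D

/-- Production rules of the R-system G(O). -/
def ProdRule (O : Ontology) (s : Role) (T : List Role) : Prop :=
  ∃ ria ∈ O.rias, (s = ria.rhs ∧ T = ria.lhs) ∨
    (s = ria.rhs.invert ∧ T = (ria.lhs.map Role.invert).reverse)

/-- One-step derivation in the R-system G(O). -/
def OneStep (O : Ontology) (S R : List Role) : Prop :=
  ∃ S' s T R', ProdRule O s T ∧ S = S' ++ s :: R' ∧ R = S' ++ T ++ R'

/-- The language L_{G(O)}(r). -/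
def lang (O : Ontology) (r : Role) : Set (List Role) :=
  {S | Relation.ReflTransGen (OneStep O) [r] S}

/-- Structural atoms: role atoms, equality atoms and inequality atoms
(labels are natural numbers). -/
inductive SAtom : Type
  | rel : Role → ℕ → ℕ → SAtom
  | eq : ℕ → ℕ → SAtom
  | neq : ℕ → ℕ → SAtom
deriving DecidableEq

/-- Labels occurring in a structural atom. -/
def SAtom.labels : SAtom → Finset ℕ
  | .rel _ x y => {x, y}
  | .eq x y => {x, y}
  | .neq x y => {x, y}

/-- Labeled concepts. -/
abbrev LC := ℕ × Concept

/-- Labels occurring in a finite set of structural atoms. -/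
def labSetF (Γ : Finset SAtom) : Finset ℕ := Γ.biUnion SAtom.labels

/-- Labels occurring in a multiset of labeled concepts. -/
def Δlabels (Δ : Multiset LC) : Finset ℕ := (Δ.map Prod.fst).toFinset

/-- One step of the equality chain x ≈ y (an equality atom in either orientation). -/
def eqStep (Γ : Set SAtom) (x y : ℕ) : Prop := SAtom.eq x y ∈ Γ ∨ SAtom.eq y x ∈ Γ

/-- x ∼_Γ y : x and y are linked by a finite chain of equality atoms of Γ. -/
def eqRel (Γ : Set SAtom) : ℕ → ℕ → Prop := Relation.ReflTransGen (eqStep Γ)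

/-- Edge of the propagation graph PG(Γ) between the classes of x and y, labeled r. -/
def pgEdge (Γ : Set SAtom) (x : ℕ) (r : Role) (y : ℕ) : Prop :=
  (∃ z w, eqRel Γ x z ∧ eqRel Γ y w ∧ SAtom.rel r z w ∈ Γ) ∨
  (∃ z w, eqRel Γ y z ∧ eqRel Γ x w ∧ SAtom.rel r.invert z w ∈ Γ)

/-- Propagation paths: PG(Γ) ⊨ [x]_Γ ⟶^S [y]_Γ for a string S of roles. -/
def pgPath (Γ : Set SAtom) : List Role → ℕ → ℕ → Prop
  | [], x, y => eqRel Γ x y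
  | r :: S, x, y => ∃ z, pgEdge Γ x r z ∧ pgPath Γ S z y

/-- PG(Γ) ⊨ [x]_Γ ⟶^L [y]_Γ with L = L_{G(O)}(r). -/
def pgLang (Γ : Set SAtom) (O : Ontology) (r : Role) (x y : ℕ) : Prop :=
  ∃ S ∈ lang O r, pgPath Γ S x y

/-- The edge relation of the directed graph determined by the role atoms of Γ. -/
def edgeRel (Γ : Set SAtom) (x y : ℕ) : Prop := ∃ r, SAtom.rel r x y ∈ Γ

/-- Γ forms a (directed) tree. -/
def FormsTree (Γ : Finset SAtom) : Prop :=
  Γ = ∅ ∨ ∃ root ∈ labSetF Γ,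
    (∀ x ∈ labSetF Γ, Relation.ReflTransGen (edgeRel ↑Γ) root x) ∧
    (∀ y, ¬ edgeRel ↑Γ y root) ∧
    (∀ x y y', edgeRel ↑Γ y x → edgeRel ↑Γ y' x → y = y')

/-- Γ ⊢ Δ is a sequent. -/
def IsSequent (Γ : Finset SAtom) (Δ : Multiset LC) : Prop :=
  FormsTree Γ ∧
  (Γ ≠ ∅ → ∀ p ∈ Δ, p.1 ∈ labSetF Γ) ∧
  (Γ = ∅ → ∃ x, Δlabels Δ = {x})

/-- y : O̅, the multiset of labeled concepts y : ¬̇C for the GCIs ⊤ ⊑ C of O. -/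
def obar (O : Ontology) (y : ℕ) : Multiset LC := O.gcis.val.map (fun C => (y, nnfNeg C))

/-- x : O̅ for every label x in a given finite set of labels. -/
def obarFor (O : Ontology) (ls : Finset ℕ) : Multiset LC := ls.val.bind (obar O)

/-- y is fresh, i.e. does not occur in the sequent Γ ⊢ Δ. -/
def FreshLabel (y : ℕ) (Γ : Finset SAtom) (Δ : Multiset LC) : Prop :=
  y ∉ labSetF Γ ∧ ∀ p ∈ Δ, p.1 ≠ y

/-- The set {yᵢ ≠̇ yⱼ | i < j}. -/
def neqSet {n : ℕ} (ys : Fin n → ℕ) : Finset SAtom :=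
  ((Finset.univ : Finset (Fin n × Fin n)).filter (fun p => p.1 < p.2)).image
    (fun p => SAtom.neq (ys p.1) (ys p.2))

/-- The set {r(x, yᵢ) | i}. -/
def relSet {n : ℕ} (r : Role) (x : ℕ) (ys : Fin n → ℕ) : Finset SAtom :=
  (Finset.univ : Finset (Fin n)).image (fun i => SAtom.rel r x (ys i))

/-- The multiset y₀ : ¬̇C, y₀ : O̅, …, yₙ : ¬̇C, yₙ : O̅. -/
def leΔ (O : Ontology) (C : Concept) {n : ℕ} (ys : Fin n → ℕ) : Multiset LC :=
  ∑ i : Fin n, ((ys i, nnfNeg C) ::ₘ obar O (ys i))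

/-- The sequent calculus S(O): `Deriv O Γ Δ n` states that the sequent Γ ⊢ Δ has
a proof in S(O) of height at most n. -/
inductive Deriv (O : Ontology) : Finset SAtom → Multiset LC → ℕ → Prop
  | id (Γ : Finset SAtom) (Δ : Multiset LC) (x A : ℕ) (n : ℕ) :
      Deriv O Γ ((x, Concept.atom A) ::ₘ (x, Concept.nneg A) ::ₘ Δ) n
  | idEq (Γ : Finset SAtom) (Δ : Multiset LC) (x y : ℕ) (n : ℕ)
      (hmem : SAtom.neq x y ∈ Γ) (h : eqRel ↑Γ x y) :
      Deriv O Γ Δ n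
  | subst (Γ : Finset SAtom) (Δ : Multiset LC) (x y : ℕ) (L : Concept) (n : ℕ)
      (hL : IsLiteral L) (h : eqRel ↑Γ x y)
      (p : Deriv O Γ ((x, L) ::ₘ (y, L) ::ₘ Δ) n) :
      Deriv O Γ ((x, L) ::ₘ Δ) (n + 1)
  | orR (Γ : Finset SAtom) (Δ : Multiset LC) (x : ℕ) (C D : Concept) (n : ℕ)
      (p : Deriv O Γ ((x, C) ::ₘ (x, D) ::ₘ Δ) n) :
      Deriv O Γ ((x, Concept.union C D) ::ₘ Δ) (n + 1)
  | andR (Γ : Finset SAtom) (Δ : Multiset LC) (x : ℕ) (C D : Concept) (n : ℕ)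
      (p : Deriv O Γ ((x, C) ::ₘ Δ) n) (q : Deriv O Γ ((x, D) ::ₘ Δ) n) :
      Deriv O Γ ((x, Concept.inter C D) ::ₘ Δ) (n + 1)
  | exR (Γ : Finset SAtom) (Δ : Multiset LC) (x y : ℕ) (r : Role) (C : Concept) (n : ℕ)
      (h : pgLang ↑Γ O r x y)
      (p : Deriv O Γ ((x, Concept.ex r C) ::ₘ (y, C) ::ₘ Δ) n) :
      Deriv O Γ ((x, Concept.ex r C) ::ₘ Δ) (n + 1)
  | allR (Γ : Finset SAtom) (Δ : Multiset LC) (x y : ℕ) (r : Role) (C : Concept) (n : ℕ)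
      (hy : FreshLabel y Γ ((x, Concept.all r C) ::ₘ Δ))
      (p : Deriv O (insert (SAtom.rel r x y) Γ) ((y, C) ::ₘ (obar O y + Δ)) n) :
      Deriv O Γ ((x, Concept.all r C) ::ₘ Δ) (n + 1)
  | leR (Γ : Finset SAtom) (Δ : Multiset LC) (x : ℕ) (r : Role) (C : Concept)
      (k : ℕ) (n : ℕ) (ys : Fin (k + 1) → ℕ)
      (hinj : Function.Injective ys)
      (hfresh : ∀ i, FreshLabel (ys i) Γ ((x, Concept.atMost k r C) ::ₘ Δ))
      (p : Deriv O (Γ ∪ neqSet ys ∪ relSet r x ys) (leΔ O C ys + Δ) n) :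
      Deriv O Γ ((x, Concept.atMost k r C) ::ₘ Δ) (n + 1)
  | geR (Γ : Finset SAtom) (Δ : Multiset LC) (x : ℕ) (r : Role) (C : Concept)
      (k : ℕ) (n : ℕ) (ys : Fin k → ℕ)
      (hpath : ∀ i, pgLang ↑Γ O r x (ys i))
      (p : ∀ i, Deriv O Γ ((ys i, C) ::ₘ (x, Concept.atLeast k r C) ::ₘ Δ) n)
      (q : ∀ i j : Fin k, i < j →
        Deriv O (insert (SAtom.eq (ys i) (ys j)) Γ) ((x, Concept.atLeast k r C) ::ₘ Δ) n) :
      Deriv O Γ ((x, Concept.atLeast k r C) ::ₘ Δ) (n + 1)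

/-- S(O) ⊩ Γ ⊢ Δ. -/
def SProvable (O : Ontology) (Γ : Finset SAtom) (Δ : Multiset LC) : Prop := ∃ n, Deriv O Γ Δ n

/-- Satisfaction of a structural atom under a label assignment. -/
def satAtom {δ : Type} (I : Interp δ) (lam : ℕ → δ) : SAtom → Prop
  | .rel r x y => (lam x, lam y) ∈ I.roleI r
  | .eq x y => lam x = lam y
  | .neq x y => lam x ≠ lam y

/-- I, λ ⊨^∀ Γ. -/
def satAll {δ : Type} (I : Interp δ) (lam : ℕ → δ) (Γ : Set SAtom) : Prop :=
  ∀ a ∈ Γ, satAtom I lam a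

/-- I, λ ⊨^∃ Δ. -/
def satEx {δ : Type} (I : Interp δ) (lam : ℕ → δ) (Δ : Multiset LC) : Prop :=
  ∃ p ∈ Δ, lam p.1 ∈ I.cInterp p.2

/-- ⊨_O Γ ⊢ Δ : validity of a sequent relative to O. -/
def ValidSeq (O : Ontology) (Γ : Finset SAtom) (Δ : Multiset LC) : Prop :=
  ∀ (δ : Type) [Nonempty δ] (I : Interp δ) (lam : ℕ → δ),
    I.models O → satAll I lam ↑Γ → satEx I lam Δ

/-- Label substitution (x/y) on labels: replace y by x. -/
def substLab (x y z : ℕ) : ℕ := if z = y then x else z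

/-- Label substitution (x/y) on structural atoms. -/
def SAtom.substL (x y : ℕ) : SAtom → SAtom
  | .rel r a b => .rel r (substLab x y a) (substLab x y b)
  | .eq a b => .eq (substLab x y a) (substLab x y b)
  | .neq a b => .neq (substLab x y a) (substLab x y b)

/-- Label substitution (x/y) on the antecedent. -/
def substΓ (x y : ℕ) (Γ : Finset SAtom) : Finset SAtom := Γ.image (SAtom.substL x y)

/-- Label substitution (x/y) on the consequent. -/
def substΔ (x y : ℕ) (Δ : Multiset LC) : Multiset LC := Δ.map (fun p => (substLab x y p.1, p.2))

/-- Exactly one of three propositions holds. -/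
def XOr3 (a b c : Prop) : Prop := (a ∧ ¬b ∧ ¬c) ∨ (¬a ∧ b ∧ ¬c) ∨ (¬a ∧ ¬b ∧ c)

/-- A member Γᵢ ⊢ Δᵢ of an interpolant. -/
abbrev ISeq := (Finset SAtom) × (Finset LC)

/-- 𝒢 is an interpolant: every member's antecedent consists of equality and
inequality atoms between distinct labels. -/
def IsInterpolant (G : Finset ISeq) : Prop :=
  ∀ p ∈ G, ∀ a ∈ p.1, ∃ x y : ℕ, x ≠ y ∧ (a = SAtom.eq x y ∨ a = SAtom.neq x y)

/-- The orthogonality condition between a member p of 𝒢 and a candidate q. -/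
def orthCond (p q : ISeq) : Prop :=
  XOr3 (∃ x y, SAtom.eq x y ∈ q.1 ∧ SAtom.neq x y ∈ p.1)
       (∃ x y, SAtom.neq x y ∈ q.1 ∧ SAtom.eq x y ∈ p.1)
       (∃ x C, (x, nnfNeg C) ∈ q.2 ∧ (x, C) ∈ p.2)

/-- The orthogonal 𝒢^⊥. -/
def OrthP (G : Set ISeq) : Set ISeq := {q | ∀ p ∈ G, orthCond p q}

/-- Labels occurring in a member of an interpolant. -/
def iseqLabels (p : ISeq) : Finset ℕ := labSetF p.1 ∪ p.2.image Prod.fst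

/-- Concept names occurring in a multiset of labeled concepts. -/
def ΔcnamesS (Δ : Multiset LC) : Set ℕ := {A | ∃ p ∈ Δ, A ∈ cnames p.2}

/-- Disjunction of a list of concepts. -/
def bigUnionL : List Concept → Concept
  | [] => botC
  | [C] => C
  | C :: D :: L => .union C (bigUnionL (D :: L))

/-- Conjunction of a list of concepts. -/
def bigInterL : List Concept → Concept
  | [] => topC
  | [C] => C
  | C :: D :: L => .inter C (bigInterL (D :: L))

/-- ⊓⊔𝒢 : the conjunction of the disjunctions of the members of 𝒢. -/
def interUnion (G : List (List Concept)) : Concept := bigInterL (G.map bigUnionL)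

/-- The interpolant {(⊢ x : C_{i,1}, …, x : C_{i,k_i}) | 1 ≤ i ≤ n}, as a set of ISeqs. -/
def simpleG (x : ℕ) (G : List (List Concept)) : Set ISeq :=
  {p | ∃ S ∈ G, p = (∅, (S.map (fun C => (x, C))).toFinset)}

/-- Renaming of concept names in a concept. -/
def renameC (ρ : ℕ → ℕ) : Concept → Concept
  | .atom A => .atom (ρ A)
  | .nneg A => .nneg (ρ A)
  | .inter C D => .inter (renameC ρ C) (renameC ρ D)
  | .union C D => .union (renameC ρ C) (renameC ρ D)
  | .ex r C => .ex r (renameC ρ C)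
  | .all r C => .all r (renameC ρ C)
  | .atMost n r C => .atMost n r (renameC ρ C)
  | .atLeast n r C => .atLeast n r (renameC ρ C)

/-- Renaming of concept names in an ontology. -/
def renameO (ρ : ℕ → ℕ) (O : Ontology) : Ontology := ⟨O.rias, O.gcis.image (renameC ρ)⟩

/-- C is implicitly concept-definable from Θ under O. -/
def ImplicitlyDefinable (C : Concept) (O : Ontology) (Θ : Finset ℕ) : Prop :=
  ∀ (δ : Type) [Nonempty δ] (I J : Interp δ), I.models O → J.models O →
    (∀ r, I.rI r = J.rI r) → (∀ A ∈ Θ, I.cI A = J.cI A) →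
    I.cInterp C = J.cInterp C

/-- C is explicitly concept-definable from Θ under O. -/
def ExplicitlyDefinable (C : Concept) (O : Ontology) (Θ : Finset ℕ) : Prop :=
  ∃ D : Concept, cnames D ⊆ Θ ∧ entails O C D ∧ entails O D C

/-- RIQ has the concept interpolation property. -/
def ConceptInterpolationProperty : Prop :=
  ∀ (O₁ O₂ : Ontology) (C D : Concept), entails (O₁.union O₂) C D →
    ∃ I : Concept, cnames I ⊆ (cnames C ∪ O₁.cnames) ∩ (cnames D ∪ O₂.cnames) ∧
      entails (O₁.union O₂) C I ∧ entails (O₁.union O₂) I D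

/-- RIQ has the concept-based Beth definability property. -/
def CBP : Prop :=
  ∀ (C : Concept) (O : Ontology) (Θ : Finset ℕ), Θ ⊆ cnames C ∪ O.cnames →
    ImplicitlyDefinable C O Θ → ExplicitlyDefinable C O Θ

theorem Role.invert_invert (r : Role) : r.invert.invert = r := by
  cases r <;> rfl

/-! ### Countability of the syntax -/

instance : Countable Role :=
  Function.Injective.countable
    (f := fun r : Role => (match r with | .name n => Sum.inl n | .inv n => Sum.inr n : ℕ ⊕ ℕ))
    (by rintro (_ | _) (_ | _) h <;> simp_all)

/-- Concepts as trees with countably many node labels, listed with the root first. -/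
def Concept.code : Concept → List (ℕ ⊕ (ℕ × Option Role))
  | .atom A => [.inr (0, none), .inl A]
  | .nneg A => [.inr (1, none), .inl A]
  | .inter C D => .inr (2, none) :: (C.code ++ D.code)
  | .union C D => .inr (3, none) :: (C.code ++ D.code)
  | .ex r C => .inr (4, some r) :: C.code
  | .all r C => .inr (5, some r) :: C.code
  | .atMost n r C => .inr (6, some r) :: .inl n :: C.code
  | .atLeast n r C => .inr (7, some r) :: .inl n :: C.code

theorem Concept.code_append_inj (C D : Concept) (S T : List (ℕ ⊕ (ℕ × Option Role)))
    (h : C.code ++ S = D.code ++ T) : C = D ∧ S = T := by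
  induction C generalizing D S T with
  | atom A => cases D <;> simp_all [Concept.code]
  | nneg A => cases D <;> simp_all [Concept.code]
  | inter C₁ C₂ ih₁ ih₂ | union C₁ C₂ ih₁ ih₂ =>
    cases D <;> simp [Concept.code] at h
    obtain ⟨rfl, h'⟩ := ih₁ _ _ _ h
    obtain ⟨rfl, h''⟩ := ih₂ _ _ _ h'
    exact ⟨rfl, h''⟩
  | ex r C ih | all r C ih | atMost n r C ih | atLeast n r C ih =>
    cases D <;> simp [Concept.code] at h
    simp_all; exact ih _ _ _ (by tauto)

instance : Countable Concept :=
  Function.Injective.countable (f := Concept.code) fun C D h =>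
    (Concept.code_append_inj C D [] [] (by rw [h])).1

/-! ### Semantics of the negation normal form -/

theorem cInterp_nnfNeg {δ : Type} (I : Interp δ) (C : Concept) :
    I.cInterp (nnfNeg C) = (I.cInterp C)ᶜ := by
  induction C with
  | atom A => rfl
  | nneg A => simp [nnfNeg, Interp.cInterp]
  | inter C D ihC ihD => simp [nnfNeg, Interp.cInterp, ihC, ihD, Set.compl_inter]
  | union C D ihC ihD => simp [nnfNeg, Interp.cInterp, ihC, ihD]
  | ex r C ih => ext a; simp [nnfNeg, Interp.cInterp, ih]
  | all r C ih => ext a; simp [nnfNeg, Interp.cInterp, ih]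
  | atMost n r C ih =>
    ext a
    simp only [nnfNeg, Interp.cInterp, Set.mem_ofPred_eq, Set.mem_compl_iff, not_le, Nat.cast_add,
      Nat.cast_one]
    exact ENat.add_one_le_iff (ENat.natCast_ne_top n)
  | atLeast n r C ih =>
    ext a
    cases n with
    | zero => simp [nnfNeg, botC, Interp.cInterp]
    | succ n =>
      simp only [nnfNeg, Interp.cInterp, Set.mem_ofPred_eq, Set.mem_compl_iff, not_le, Nat.cast_add,
        Nat.cast_one]
      exact (ENat.lt_add_one_iff (ENat.natCast_ne_top n)).symm

/-- A size measure on concepts that does not grow under negation. -/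
def Concept.size : Concept → ℕ
  | .atom _ => 1
  | .nneg _ => 1
  | .inter C D => C.size + D.size + 1
  | .union C D => C.size + D.size + 1
  | .ex _ C => C.size + 1
  | .all _ C => C.size + 1
  | .atMost _ _ C => C.size + 3
  | .atLeast _ _ C => C.size + 3

theorem size_nnfNeg_le (C : Concept) : (nnfNeg C).size ≤ C.size := by
  induction C with
  | atLeast n r C ih => cases n <;> simp [nnfNeg, Concept.size, botC]
  | _ => simp [nnfNeg, Concept.size] <;> omega

/-! ### Equality classes and propagation paths -/

section Propagation

variable {Γ Γ' : Set SAtom} {x y z : ℕ}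

theorem eqStep_symm (h : eqStep Γ x y) : eqStep Γ y x := Or.symm h

theorem eqRel_symm (h : eqRel Γ x y) : eqRel Γ y x :=
  have : Std.Symm (eqStep Γ) := ⟨fun _ _ => eqStep_symm⟩
  Std.Symm.symm (r := Relation.ReflTransGen (eqStep Γ)) _ _ h

theorem eqRel_mono (hΓ : Γ ⊆ Γ') (h : eqRel Γ x y) : eqRel Γ' x y :=
  Relation.ReflTransGen.mono (fun _ _ => Or.imp (@hΓ _) (@hΓ _)) _ _ h

theorem pgEdge_mono (hΓ : Γ ⊆ Γ') {r : Role} (h : pgEdge Γ x r y) : pgEdge Γ' x r y := by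
  rcases h with ⟨z, w, h₁, h₂, h₃⟩ | ⟨z, w, h₁, h₂, h₃⟩
  · exact .inl ⟨z, w, eqRel_mono hΓ h₁, eqRel_mono hΓ h₂, hΓ h₃⟩
  · exact .inr ⟨z, w, eqRel_mono hΓ h₁, eqRel_mono hΓ h₂, hΓ h₃⟩

theorem pgPath_mono (hΓ : Γ ⊆ Γ') {S : List Role} (h : pgPath Γ S x y) : pgPath Γ' S x y := by
  induction S generalizing x with
  | nil => exact eqRel_mono hΓ h
  | cons r S ih =>
    obtain ⟨z, hz, h⟩ := h
    exact ⟨z, pgEdge_mono hΓ hz, ih h⟩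

theorem pgLang_mono (hΓ : Γ ⊆ Γ') {O : Ontology} {r : Role} (h : pgLang Γ O r x y) :
    pgLang Γ' O r x y :=
  let ⟨S, hS, h⟩ := h
  ⟨S, hS, pgPath_mono hΓ h⟩

theorem pgEdge_symm {r : Role} (h : pgEdge Γ x r y) : pgEdge Γ y r.invert x := by
  rcases h with h | h
  · exact .inr (by rwa [Role.invert_invert])
  · exact .inl h

theorem pgEdge_of_eqRel_left {r : Role} (h : eqRel Γ x y) (h' : pgEdge Γ y r z) :
    pgEdge Γ x r z := by
  rcases h' with ⟨u, w, h₁, h₂, h₃⟩ | ⟨u, w, h₁, h₂, h₃⟩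
  · exact .inl ⟨u, w, h.trans h₁, h₂, h₃⟩
  · exact .inr ⟨u, w, h₁, h.trans h₂, h₃⟩

theorem pgPath_of_eqRel_left {S : List Role} (h : eqRel Γ x y) (h' : pgPath Γ S y z) :
    pgPath Γ S x z := by
  cases S with
  | nil => exact Relation.ReflTransGen.trans h h'
  | cons r S =>
    obtain ⟨w, hw, h'⟩ := h'
    exact ⟨w, pgEdge_of_eqRel_left h hw, h'⟩

theorem pgPath_append {S T : List Role} (h : pgPath Γ S x y) (h' : pgPath Γ T y z) :
    pgPath Γ (S ++ T) x z := by
  induction S generalizing x with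
  | nil => exact pgPath_of_eqRel_left h h'
  | cons r S ih =>
    obtain ⟨w, hw, h⟩ := h
    exact ⟨w, hw, ih h⟩

theorem pgPath_of_rel {r : Role} (h : SAtom.rel r x y ∈ Γ) : pgPath Γ [r] x y :=
  ⟨y, .inl ⟨x, y, .refl, .refl, h⟩, .refl⟩

theorem pgPath_reverse {S : List Role} (h : pgPath Γ S x y) :
    pgPath Γ (S.map Role.invert).reverse y x := by
  induction S generalizing x with
  | nil => exact eqRel_symm h
  | cons r S ih =>
    obtain ⟨w, hw, h⟩ := h
    rw [List.map_cons, List.reverse_cons]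
    exact pgPath_append (ih h) ⟨x, pgEdge_symm hw, .refl⟩

theorem pgPath_of_eqRel_right {S : List Role} (h : pgPath Γ S x y) (h' : eqRel Γ y z) :
    pgPath Γ S x z := by
  simpa using pgPath_append (T := []) h h'

theorem pgLang_congr {O : Ontology} {r : Role} {x' y' : ℕ} (hx : eqRel Γ x x')
    (hy : eqRel Γ y y') (h : pgLang Γ O r x y) : pgLang Γ O r x' y' :=
  let ⟨S, hS, h⟩ := h
  ⟨S, hS, pgPath_of_eqRel_left (eqRel_symm hx) (pgPath_of_eqRel_right h hy)⟩

theorem eqRel_mem_labels {V : Set ℕ} (hV : ∀ a ∈ Γ, ∀ z ∈ a.labels, z ∈ V) (hx : x ∈ V)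
    (h : eqRel Γ x y) : y ∈ V := by
  induction h with
  | refl => exact hx
  | tail _ h _ =>
    rcases h with h | h
    · exact hV _ h _ (by simp [SAtom.labels])
    · exact hV _ h _ (by simp [SAtom.labels])

theorem pgPath_mem_labels {V : Set ℕ} (hV : ∀ a ∈ Γ, ∀ z ∈ a.labels, z ∈ V) (hx : x ∈ V)
    {S : List Role} (h : pgPath Γ S x y) : y ∈ V := by
  induction S generalizing x with
  | nil => exact eqRel_mem_labels hV hx h
  | cons r S ih =>
    obtain ⟨w, hw, h⟩ := h
    refine ih ?_ h
    rcases hw with ⟨u, v, _, h₂, h₃⟩ | ⟨u, v, h₁, _, h₃⟩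
    · exact eqRel_mem_labels hV (hV _ h₃ v (by simp [SAtom.labels])) (eqRel_symm h₂)
    · exact eqRel_mem_labels hV (hV _ h₃ u (by simp [SAtom.labels])) (eqRel_symm h₁)

section Directed

variable {ι : Type*} [Nonempty ι] {G : ι → Set SAtom}

theorem exists_eqRel_of_iUnion (hG : Directed (· ⊆ ·) G)
    (h : eqRel (⋃ i, G i) x y) : ∃ i, eqRel (G i) x y := by
  induction h with
  | refl => exact ⟨Classical.arbitrary ι, .refl⟩
  | @tail y z _ h ih =>
    obtain ⟨i, hi⟩ := ih
    obtain ⟨j, hj⟩ : ∃ j, eqStep (G j) y z := by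
      rcases h with h | h
      · exact (Set.mem_iUnion.1 h).imp fun _ => Or.inl
      · exact (Set.mem_iUnion.1 h).imp fun _ => Or.inr
    obtain ⟨k, hik, hjk⟩ := hG i j
    exact ⟨k, (eqRel_mono hik hi).tail (Or.imp (@hjk _) (@hjk _) hj)⟩

theorem exists_pgEdge_of_iUnion {r : Role} (hG : Directed (· ⊆ ·) G)
    (h : pgEdge (⋃ i, G i) x r y) :
    ∃ i, pgEdge (G i) x r y := by
  have key : ∀ (s : Role) (a b : ℕ), (∃ z w, eqRel (⋃ i, G i) a z ∧ eqRel (⋃ i, G i) b w ∧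
      SAtom.rel s z w ∈ ⋃ i, G i) →
      ∃ i, ∃ z w, eqRel (G i) a z ∧ eqRel (G i) b w ∧ SAtom.rel s z w ∈ G i := by
    rintro s a b ⟨z, w, h₁, h₂, h₃⟩
    obtain ⟨i, hi⟩ := exists_eqRel_of_iUnion hG h₁
    obtain ⟨j, hj⟩ := exists_eqRel_of_iUnion hG h₂
    obtain ⟨k, hk⟩ := Set.mem_iUnion.1 h₃
    obtain ⟨l, hil, hjl⟩ := hG i j
    obtain ⟨m, hlm, hkm⟩ := hG l k
    exact ⟨m, z, w, eqRel_mono (hil.trans hlm) hi, eqRel_mono (hjl.trans hlm) hj, hkm hk⟩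
  rcases h with h | h
  · exact (key _ _ _ h).imp fun _ => Or.inl
  · exact (key _ _ _ h).imp fun _ => Or.inr

theorem exists_pgPath_of_iUnion {S : List Role} (hG : Directed (· ⊆ ·) G)
    (h : pgPath (⋃ i, G i) S x y) :
    ∃ i, pgPath (G i) S x y := by
  induction S generalizing x with
  | nil => exact exists_eqRel_of_iUnion hG h
  | cons r S ih =>
    obtain ⟨w, hw, h⟩ := h
    obtain ⟨i, hi⟩ := exists_pgEdge_of_iUnion hG hw
    obtain ⟨j, hj⟩ := ih h
    obtain ⟨k, hik, hjk⟩ := hG i j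
    exact ⟨k, w, pgEdge_mono hik hi, pgPath_mono hjk hj⟩

theorem exists_pgLang_of_iUnion {O : Ontology} {r : Role} (hG : Directed (· ⊆ ·) G)
    (h : pgLang (⋃ i, G i) O r x y) :
    ∃ i, pgLang (G i) O r x y :=
  let ⟨S, hS, h⟩ := h
  (exists_pgPath_of_iUnion hG h).imp fun _ h => ⟨S, hS, h⟩

end Directed

end Propagation

/-! ### Derivations in the R-system -/

section RSystem

variable {O : Ontology}

theorem OneStep.append_left {S T : List Role} (U : List Role) (h : OneStep O S T) :
    OneStep O (U ++ S) (U ++ T) := by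
  obtain ⟨S', s, W, R', hp, rfl, rfl⟩ := h
  exact ⟨U ++ S', s, W, R', hp, by simp, by simp⟩

theorem OneStep.append_right {S T : List Role} (U : List Role) (h : OneStep O S T) :
    OneStep O (S ++ U) (T ++ U) := by
  obtain ⟨S', s, W, R', hp, rfl, rfl⟩ := h
  exact ⟨S', s, W, R' ++ U, hp, by simp, by simp⟩

theorem derives_append {S S' T T' : List Role} (hS : Relation.ReflTransGen (OneStep O) S S')
    (hT : Relation.ReflTransGen (OneStep O) T T') :
    Relation.ReflTransGen (OneStep O) (S ++ T) (S' ++ T') :=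
  (Relation.ReflTransGen.lift (· ++ T) (fun _ _ => OneStep.append_right T) _ _ hS).trans
    (Relation.ReflTransGen.lift (S' ++ ·) (fun _ _ => OneStep.append_left S') _ _ hT)

theorem map_invert_map_invert (S : List Role) : (S.map Role.invert).map Role.invert = S := by
  induction S <;> simp_all [Role.invert_invert]

theorem ProdRule.invert {s : Role} {T : List Role} (h : ProdRule O s T) :
    ProdRule O s.invert (T.map Role.invert).reverse := by
  obtain ⟨ria, hria, ⟨rfl, rfl⟩ | ⟨rfl, rfl⟩⟩ := h
  · exact ⟨ria, hria, .inr ⟨rfl, rfl⟩⟩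
  · refine ⟨ria, hria, .inl ⟨Role.invert_invert _, ?_⟩⟩
    rw [List.map_reverse, List.reverse_reverse, map_invert_map_invert]

theorem OneStep.invert {S T : List Role} (h : OneStep O S T) :
    OneStep O (S.map Role.invert).reverse (T.map Role.invert).reverse := by
  obtain ⟨S', s, W, R', hp, rfl, rfl⟩ := h
  exact ⟨(R'.map Role.invert).reverse, s.invert, _, (S'.map Role.invert).reverse, hp.invert,
    by simp, by simp⟩

theorem lang_invert {r : Role} {S : List Role} (h : S ∈ lang O r) :
    (S.map Role.invert).reverse ∈ lang O r.invert :=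
  Relation.ReflTransGen.lift (r := OneStep O) (p := OneStep O)
    (fun S => (S.map Role.invert).reverse)
    (fun _ _ => OneStep.invert) _ _ h

theorem pgLang_symm {Γ : Set SAtom} {r : Role} {x y : ℕ} (h : pgLang Γ O r x y) :
    pgLang Γ O r.invert y x :=
  let ⟨_, hS, h⟩ := h
  ⟨_, lang_invert hS, pgPath_reverse h⟩

end RSystem

/-! ### The canonical countermodel of a Hintikka set -/

/-- A saturated, possibly infinite sequent: `Γ` is its antecedent, `H` its consequent and `V` the
set of labels in use. -/
structure IsHintikka (O : Ontology) (Γ : Set SAtom) (H : Set LC) (V : Set ℕ) : Prop where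
  literal : ∀ x y A, (x, Concept.atom A) ∈ H → (y, Concept.nneg A) ∈ H → ¬ eqRel Γ x y
  neq : ∀ x y, SAtom.neq x y ∈ Γ → ¬ eqRel Γ x y
  inter : ∀ x C D, (x, Concept.inter C D) ∈ H → (x, C) ∈ H ∨ (x, D) ∈ H
  union : ∀ x C D, (x, Concept.union C D) ∈ H → (x, C) ∈ H ∧ (x, D) ∈ H
  ex : ∀ x y r C, (x, Concept.ex r C) ∈ H → pgLang Γ O r x y → (y, C) ∈ H
  all : ∀ x r C, (x, Concept.all r C) ∈ H → ∃ y, SAtom.rel r x y ∈ Γ ∧ (y, C) ∈ H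
  atMost : ∀ x k r C, (x, Concept.atMost k r C) ∈ H → ∃ ys : Fin (k + 1) → ℕ,
    (∀ i, SAtom.rel r x (ys i) ∈ Γ) ∧ (∀ i j, i < j → SAtom.neq (ys i) (ys j) ∈ Γ) ∧
      ∀ i, (ys i, nnfNeg C) ∈ H
  atLeast : ∀ x k r C (ys : Fin k → ℕ), (x, Concept.atLeast k r C) ∈ H →
    (∀ i, pgLang Γ O r x (ys i)) →
      (∃ i, (ys i, C) ∈ H) ∨ ∃ i j, i < j ∧ SAtom.eq (ys i) (ys j) ∈ Γ
  atom_labels : ∀ a ∈ Γ, ∀ z ∈ a.labels, z ∈ V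
  label_mem : ∀ f ∈ H, f.1 ∈ V
  gci : ∀ v ∈ V, ∀ C ∈ O.gcis, (v, nnfNeg C) ∈ H

/-- Equality of labels modulo `Γ`. -/
def eqSetoid (Γ : Set SAtom) : Setoid ℕ where
  r := eqRel Γ
  iseqv := ⟨fun _ => .refl, eqRel_symm, .trans⟩

/-- A chosen representative of the class of a label. -/
noncomputable def rep (Γ : Set SAtom) (x : ℕ) : ℕ := (Quotient.mk (eqSetoid Γ) x).out

theorem eqRel_rep (Γ : Set SAtom) (x : ℕ) : eqRel Γ (rep Γ x) x :=
  Quotient.mk_out (s := eqSetoid Γ) x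

theorem rep_eq_rep_iff {Γ : Set SAtom} {x y : ℕ} : rep Γ x = rep Γ y ↔ eqRel Γ x y := by
  rw [rep, rep, Quotient.out_inj, Quotient.eq]
  rfl

theorem rep_rep (Γ : Set SAtom) (x : ℕ) : rep Γ (rep Γ x) = rep Γ x :=
  rep_eq_rep_iff.2 (eqRel_rep Γ x)

/-- The domain of the canonical model: one label for each class of labels in use. -/
abbrev CanonDom (Γ : Set SAtom) (V : Set ℕ) : Type := {x : ℕ // x ∈ V ∧ rep Γ x = x}

/-- The canonical model. -/
def canonModel (O : Ontology) (Γ : Set SAtom) (H : Set LC) (V : Set ℕ) :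
    Interp (CanonDom Γ V) where
  cI A := {a | ∃ y, eqRel Γ a.1 y ∧ (y, Concept.nneg A) ∈ H}
  rI n := {p | pgLang Γ O (.name n) p.1.1 p.2.1}

section Canonical

variable {O : Ontology} {Γ : Set SAtom} {H : Set LC} {V : Set ℕ}

theorem mem_roleI_canonModel {r : Role} {a b : CanonDom Γ V} :
    (a, b) ∈ (canonModel O Γ H V).roleI r ↔ pgLang Γ O r a.1 b.1 := by
  cases r with
  | name n => rfl
  | inv n => exact ⟨fun h => pgLang_symm (r := .name n) h, fun h => pgLang_symm (r := .inv n) h⟩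

theorem exists_pgPath_of_mem_listComp {L : List Role} {a b : CanonDom Γ V}
    (h : (a, b) ∈ (canonModel O Γ H V).listComp L) :
    ∃ S, Relation.ReflTransGen (OneStep O) L S ∧ pgPath Γ S a.1 b.1 := by
  induction L generalizing a with
  | nil =>
    obtain rfl : a = b := h
    exact ⟨[], .refl, Relation.ReflTransGen.refl⟩
  | cons r L ih =>
    obtain ⟨c, hac, hcb⟩ := h
    obtain ⟨S, hS, hp⟩ := mem_roleI_canonModel.1 hac
    obtain ⟨T, hT, hq⟩ := ih hcb
    exact ⟨S ++ T, derives_append (S := [r]) hS hT, pgPath_append hp hq⟩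

theorem canonModel_ria {ria : RIA} (hria : ria ∈ O.rias) :
    (canonModel O Γ H V).listComp ria.lhs ⊆ (canonModel O Γ H V).roleI ria.rhs := by
  rintro ⟨a, b⟩ h
  obtain ⟨S, hS, hp⟩ := exists_pgPath_of_mem_listComp h
  refine mem_roleI_canonModel.2 ⟨S, .head ?_ hS, hp⟩
  exact ⟨[], ria.rhs, ria.lhs, [], ⟨ria, hria, .inl ⟨rfl, rfl⟩⟩, rfl, by simp⟩

namespace IsHintikka

theorem rep_mem (hH : IsHintikka O Γ H V) {x : ℕ} (hx : x ∈ V) :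
    rep Γ x ∈ V ∧ rep Γ (rep Γ x) = rep Γ x :=
  ⟨eqRel_mem_labels hH.atom_labels hx (eqRel_symm (eqRel_rep Γ x)), rep_rep Γ x⟩

/-- The element of the canonical model denoted by a label in use. -/
noncomputable def elt (hH : IsHintikka O Γ H V) {x : ℕ} (hx : x ∈ V) : CanonDom Γ V :=
  ⟨rep Γ x, hH.rep_mem hx⟩

theorem elt_eq (hH : IsHintikka O Γ H V) (a : CanonDom Γ V) : hH.elt a.2.1 = a := Subtype.ext a.2.2

theorem mem_roleI_elt (hH : IsHintikka O Γ H V) {r : Role} {x y : ℕ} (hx : x ∈ V) (hy : y ∈ V) :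
    (hH.elt hx, hH.elt hy) ∈ (canonModel O Γ H V).roleI r ↔ pgLang Γ O r x y := by
  rw [mem_roleI_canonModel]
  exact ⟨pgLang_congr (eqRel_rep Γ x) (eqRel_rep Γ y),
    pgLang_congr (eqRel_symm (eqRel_rep Γ x)) (eqRel_symm (eqRel_rep Γ y))⟩

/-- Every labeled concept of a Hintikka set is false in the canonical model. -/
theorem notMem_cInterp (hH : IsHintikka O Γ H V) {x : ℕ} {F : Concept} (hF : (x, F) ∈ H) :
    hH.elt (hH.label_mem _ hF) ∉ (canonModel O Γ H V).cInterp F := by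
  induction hn : F.size using Nat.strong_induction_on generalizing x F with
  | _ n ih =>
  subst hn
  have hx : x ∈ V := hH.label_mem _ hF
  cases F with
  | atom A =>
    rintro ⟨y, hxy, hy⟩
    exact hH.literal _ _ _ hF hy ((eqRel_symm (eqRel_rep Γ x)).trans hxy)
  | nneg A => exact fun h => h ⟨x, eqRel_rep Γ x, hF⟩
  | inter C D =>
    rintro ⟨hC, hD⟩
    rcases hH.inter _ _ _ hF with h | h
    · exact ih _ (by simp only [Concept.size]; omega) h rfl hC
    · exact ih _ (by simp only [Concept.size]; omega) h rfl hD
  | union C D =>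
    obtain ⟨h₁, h₂⟩ := hH.union _ _ _ hF
    rintro (h | h)
    · exact ih _ (by simp only [Concept.size]; omega) h₁ rfl h
    · exact ih _ (by simp only [Concept.size]; omega) h₂ rfl h
  | ex r C =>
    rintro ⟨b, hb, hC⟩
    rw [← hH.elt_eq b] at hb hC
    have h := hH.ex _ _ _ _ hF ((hH.mem_roleI_elt hx _).1 hb)
    exact ih _ (by simp only [Concept.size]; omega) h rfl hC
  | all r C =>
    obtain ⟨y, hy, hyC⟩ := hH.all _ _ _ hF
    intro h
    refine ih _ (by simp only [Concept.size]; omega) hyC rfl (h _ ?_)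
    exact (hH.mem_roleI_elt hx _).2 ⟨[r], .refl, pgPath_of_rel hy⟩
  | atMost k r C =>
    obtain ⟨ys, hrel, hneq, hys⟩ := hH.atMost _ _ _ _ hF
    intro h
    have hinj : Function.Injective fun i => hH.elt (hH.label_mem _ (hys i)) := by
      intro i j hij
      have hij' : eqRel Γ (ys i) (ys j) := rep_eq_rep_iff.1 (congrArg Subtype.val hij)
      rcases lt_trichotomy i j with hlt | rfl | hlt
      · exact (hH.neq _ _ (hneq i j hlt) hij').elim
      · rfl
      · exact (hH.neq _ _ (hneq j i hlt) (eqRel_symm hij')).elim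
    have hcard := hinj.encard_range
    have hsub : (Set.range fun i => hH.elt (hH.label_mem _ (hys i))) ⊆
        {b | (hH.elt hx, b) ∈ (canonModel O Γ H V).roleI r ∧
          b ∈ (canonModel O Γ H V).cInterp C} := by
      rintro _ ⟨i, rfl⟩
      refine ⟨(hH.mem_roleI_elt hx _).2 ⟨[r], .refl, pgPath_of_rel (hrel i)⟩, ?_⟩
      have := ih _ (by have := size_nnfNeg_le C; simp only [Concept.size]; omega) (hys i) rfl
      rwa [cInterp_nnfNeg, Set.notMem_compl_iff] at this
    have hle := hcard.trans ((Set.encard_le_encard hsub).trans h)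
    rw [ENat.card_eq_coe_fintype_card, Fintype.card_fin] at hle
    exact absurd (Nat.cast_le.1 hle) (by omega)
  | atLeast k r C =>
    intro h
    obtain ⟨T, hT, hcard⟩ := Set.exists_subset_encard_eq (Set.mem_ofPred_eq ▸ h)
    have hfin : T.Finite := Set.finite_of_encard_eq_coe hcard
    have hk : Nat.card T = k := by
      rw [Nat.card_coe_set_eq, Set.ncard, hcard, ENat.toNat_natCast]
    have : Finite T := hfin
    let e : Fin k ≃ T := (Finite.equivFinOfCardEq hk).symm
    have hpath : ∀ i, pgLang Γ O r x (e i).1.1 := fun i => by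
      have := (hT (e i).2).1
      rw [← hH.elt_eq (e i).1] at this
      exact (hH.mem_roleI_elt hx _).1 this
    rcases hH.atLeast _ _ _ _ (fun i => (e i).1.1) hF hpath with ⟨i, hi⟩ | ⟨i, j, hij, heq⟩
    · have := (hT (e i).2).2
      rw [← hH.elt_eq (e i).1] at this
      exact ih _ (by simp only [Concept.size]; omega) hi rfl this
    · have h₁ : rep Γ (e i).1.1 = rep Γ (e j).1.1 := rep_eq_rep_iff.2 (.single (.inl heq))
      rw [(e i).1.2.2, (e j).1.2.2] at h₁
      exact hij.ne (e.injective (Subtype.ext (Subtype.ext h₁)))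

theorem canonModel_models (hH : IsHintikka O Γ H V) : (canonModel O Γ H V).models O := by
  refine ⟨fun C hC a _ => ?_, fun ria hria => canonModel_ria hria⟩
  have := hH.notMem_cInterp (hH.gci _ a.2.1 C hC)
  rwa [cInterp_nnfNeg, Set.notMem_compl_iff, hH.elt_eq] at this

theorem not_validSeq (hH : IsHintikka O Γ H V) {x : ℕ} {C : Concept} (hC : (x, C) ∈ H) :
    ¬ ValidSeq O ∅ {(x, C)} := by
  intro h
  have : Nonempty (CanonDom Γ V) := ⟨hH.elt (hH.label_mem _ hC)⟩
  obtain ⟨p, hp, hsat⟩ := h _ (canonModel O Γ H V) (fun _ => hH.elt (hH.label_mem _ hC))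
    hH.canonModel_models (by simp [satAll])
  obtain rfl := Multiset.mem_singleton.1 hp
  exact hH.notMem_cInterp hC hsat

end IsHintikka

end Canonical

/-! ### Generic ideals -/

/-- A Rasiowa–Sikorski argument for a countable family of monotone tasks: if every active task can
be accomplished by an extension, then some ideal accomplishes all the tasks active in it. -/
theorem exists_ideal_forall_task {P ι : Type*} [Preorder P] [Countable ι] (p : P)
    (A B : ι → P → Prop) (hA : ∀ i, Monotone (A i)) (hB : ∀ i, Monotone (B i))
    (h : ∀ i p, A i p → ∃ q, p ≤ q ∧ B i q) :
    ∃ I : Order.Ideal P, p ∈ I ∧ ∀ i, ∀ q ∈ I, A i q → ∃ s ∈ I, B i s := by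
  have := Encodable.ofCountable ι
  let D : ι → Order.Cofinal P := fun i =>
    { carrier := {q | A i q → B i q} ∩ {q | B i q ∨ ∀ s, q ≤ s → ¬ A i s}
      isCofinal := fun q => by
        by_cases hq : ∃ s, q ≤ s ∧ A i s
        · obtain ⟨s, hqs, hs⟩ := hq
          obtain ⟨t, hst, ht⟩ := h i s hs
          exact ⟨t, ⟨fun _ => ht, .inl ht⟩, hqs.trans hst⟩
        · simp only [not_exists, not_and] at hq
          exact ⟨q, ⟨fun h => (hq q le_rfl h).elim, .inr hq⟩, le_rfl⟩ }
  refine ⟨Order.idealOfCofinals p D, Order.mem_idealOfCofinals p D, fun i q hq hAq => ?_⟩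
  obtain ⟨s, ⟨_, hs⟩, hsI⟩ := Order.cofinal_meets_idealOfCofinals p D i
  obtain ⟨t, htI, hqt, hst⟩ := (Order.idealOfCofinals p D).directed q hq s hsI
  refine ⟨t, htI, ?_⟩
  rcases hs with hs | hs
  · exact hB i hst hs
  · exact (hs t hst (hA i hqt hAq)).elim

/-! ### Provability -/

section Provability

variable {O : Ontology} {Γ : Finset SAtom} {Δ : Multiset LC}

theorem exists_eq_add_one_of_succ_le {n m : ℕ} (h : n + 1 ≤ m) : ∃ k, m = k + 1 ∧ n ≤ k :=
  ⟨m - 1, by omega, by omega⟩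

theorem Deriv.mono {n m : ℕ} (h : Deriv O Γ Δ n) (hnm : n ≤ m) : Deriv O Γ Δ m := by
  induction h generalizing m with
  | id => exact .id ..
  | idEq _ _ _ _ _ hmem h => exact .idEq _ _ _ _ _ hmem h
  | subst _ _ _ _ _ _ hL h _ ih =>
    obtain ⟨m, rfl, hm⟩ := exists_eq_add_one_of_succ_le hnm
    exact .subst _ _ _ _ _ _ hL h (ih hm)
  | orR _ _ _ _ _ _ _ ih =>
    obtain ⟨m, rfl, hm⟩ := exists_eq_add_one_of_succ_le hnm
    exact .orR _ _ _ _ _ _ (ih hm)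
  | andR _ _ _ _ _ _ _ _ ihp ihq =>
    obtain ⟨m, rfl, hm⟩ := exists_eq_add_one_of_succ_le hnm
    exact .andR _ _ _ _ _ _ (ihp hm) (ihq hm)
  | exR _ _ _ _ _ _ _ h _ ih =>
    obtain ⟨m, rfl, hm⟩ := exists_eq_add_one_of_succ_le hnm
    exact .exR _ _ _ _ _ _ _ h (ih hm)
  | allR _ _ _ _ _ _ _ hy _ ih =>
    obtain ⟨m, rfl, hm⟩ := exists_eq_add_one_of_succ_le hnm
    exact .allR _ _ _ _ _ _ _ hy (ih hm)
  | leR _ _ _ _ _ _ _ _ hinj hfresh _ ih =>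
    obtain ⟨m, rfl, hm⟩ := exists_eq_add_one_of_succ_le hnm
    exact .leR _ _ _ _ _ _ _ _ hinj hfresh (ih hm)
  | geR _ _ _ _ _ _ _ _ hpath _ _ ihp ihq =>
    obtain ⟨m, rfl, hm⟩ := exists_eq_add_one_of_succ_le hnm
    exact .geR _ _ _ _ _ _ _ _ hpath (fun i => ihp i hm) (fun i j hij => ihq i j hij hm)

theorem SProvable.andR {x : ℕ} {C D : Concept} (hC : SProvable O Γ ((x, C) ::ₘ Δ))
    (hD : SProvable O Γ ((x, D) ::ₘ Δ)) : SProvable O Γ ((x, Concept.inter C D) ::ₘ Δ) :=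
  let ⟨n, hn⟩ := hC
  let ⟨m, hm⟩ := hD
  ⟨max n m + 1, .andR _ _ _ _ _ _ (hn.mono (le_max_left _ _)) (hm.mono (le_max_right _ _))⟩

theorem SProvable.geR {x k : ℕ} {r : Role} {C : Concept} {ys : Fin k → ℕ}
    (hpath : ∀ i, pgLang ↑Γ O r x (ys i))
    (p : ∀ i, SProvable O Γ ((ys i, C) ::ₘ (x, Concept.atLeast k r C) ::ₘ Δ))
    (q : ∀ i j, i < j →
      SProvable O (insert (SAtom.eq (ys i) (ys j)) Γ) ((x, Concept.atLeast k r C) ::ₘ Δ)) :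
    SProvable O Γ ((x, Concept.atLeast k r C) ::ₘ Δ) := by
  choose f hf using p
  choose g hg using q
  refine ⟨(Finset.univ.sup f ⊔ Finset.univ.sup fun i => Finset.univ.sup fun j =>
    if h : i < j then g i j h else 0) + 1, .geR _ _ _ _ _ _ _ ys hpath
      (fun i => (hf i).mono ?_) (fun i j hij => (hg i j hij).mono ?_)⟩
  · exact (Finset.le_sup (f := f) (Finset.mem_univ i)).trans le_sup_left
  · refine le_trans ?_ le_sup_right
    refine le_trans ?_ (Finset.le_sup (Finset.mem_univ i))
    refine le_trans ?_ (Finset.le_sup (Finset.mem_univ j))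
    rw [dif_pos hij]

end Provability

/-! ### Saturation of unprovable sequents -/

/-- The labeled concept `f` is one that is consumed by a rule, and the formulas and atoms of some
premise of this rule have been added to `Γ` and `H`. -/
def Reduced (Γ : Set SAtom) (H : Set LC) : LC → Prop
  | (x, .inter C D) => (x, C) ∈ H ∨ (x, D) ∈ H
  | (x, .union C D) => (x, C) ∈ H ∧ (x, D) ∈ H
  | (x, .all r C) => ∃ y, SAtom.rel r x y ∈ Γ ∧ (y, C) ∈ H
  | (x, .atMost k r C) => ∃ ys : Fin (k + 1) → ℕ,
      (∀ i, SAtom.rel r x (ys i) ∈ Γ) ∧ (∀ i j, i < j → SAtom.neq (ys i) (ys j) ∈ Γ) ∧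
        ∀ i, (ys i, nnfNeg C) ∈ H
  | _ => False

theorem Reduced.mono {Γ Γ' : Set SAtom} {H H' : Set LC} (hΓ : Γ ⊆ Γ') (hH : H ⊆ H') {f : LC}
    (h : Reduced Γ H f) : Reduced Γ' H' f := by
  obtain ⟨x, F⟩ := f
  cases F with
  | inter C D => exact Or.imp (@hH _) (@hH _) h
  | union C D => exact And.imp (@hH _) (@hH _) h
  | all r C => exact h.imp fun y => And.imp (@hΓ _) (@hH _)
  | atMost k r C =>
    obtain ⟨ys, h₁, h₂, h₃⟩ := h
    exact ⟨ys, fun i => hΓ (h₁ i), fun i j hij => hΓ (h₂ i j hij), fun i => hH (h₃ i)⟩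
  | _ => exact h.elim

/-- A stage in the saturation of an unprovable sequent: the current sequent together with the set
`H` of all labeled concepts met so far and the set `V` of all labels in use. -/
structure Stage (O : Ontology) where
  Γ : Finset SAtom
  Δ : Multiset LC
  H : Set LC
  V : Finset ℕ
  not_provable : ¬ SProvable O Γ Δ
  mem_H : ∀ f ∈ Δ, f ∈ H
  mem_or_reduced : ∀ f ∈ H, f ∈ Δ ∨ Reduced Γ H f
  atom_labels : ∀ a ∈ Γ, a.labels ⊆ V
  label_mem : ∀ f ∈ H, f.1 ∈ V
  gci : ∀ v ∈ V, ∀ C ∈ O.gcis, (v, nnfNeg C) ∈ H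

namespace Stage

variable {O : Ontology}

instance : Preorder (Stage O) where
  le p q := p.Γ ⊆ q.Γ ∧ p.H ⊆ q.H
  le_refl p := ⟨subset_rfl, subset_rfl⟩
  le_trans p q s hpq hqs := ⟨hpq.1.trans hqs.1, hpq.2.trans hqs.2⟩

theorem fresh (p : Stage O) {y : ℕ} (hy : y ∉ p.V) {f : LC} {Δ : Multiset LC}
    (hΔ : p.Δ = f ::ₘ Δ) : FreshLabel y p.Γ (f ::ₘ Δ) := by
  refine ⟨fun h => ?_, fun g hg hgy => hy ?_⟩
  · obtain ⟨a, ha, hya⟩ := Finset.mem_biUnion.1 h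
    exact hy (p.atom_labels a ha hya)
  · rw [← hgy]
    exact p.label_mem g (p.mem_H g (hΔ ▸ hg))

theorem pgLang_mem (p : Stage O) {r : Role} {x y : ℕ} (hx : x ∈ p.V)
    (h : pgLang ↑p.Γ O r x y) : y ∈ p.V :=
  let ⟨_, _, h⟩ := h
  pgPath_mem_labels (V := ↑p.V) (fun a ha _ hz => p.atom_labels a ha hz) hx h

/-- Replacing the sequent of a stage by an unprovable premise of a rule applied to it. -/
theorem exists_extension (p : Stage O) (f : LC) (Δ₀ Δ : Multiset LC) (hp : p.Δ = f ::ₘ Δ₀)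
    (Γ : Finset SAtom) (Δ' : Multiset LC) (V : Finset ℕ) (hΓ : p.Γ ⊆ Γ) (hΔ : Δ' = Δ + Δ₀)
    (hf : f ∈ Δ ∨ Reduced ↑Γ (p.H ∪ {g | g ∈ Δ}) f) (hV : p.V ⊆ V)
    (hprov : ¬ SProvable O Γ Δ')
    (hatom : ∀ a ∈ Γ, a ∉ p.Γ → a.labels ⊆ V) (hlabel : ∀ g ∈ Δ, g.1 ∈ V)
    (hgci : ∀ v ∈ V, v ∉ p.V → ∀ C ∈ O.gcis, (v, nnfNeg C) ∈ Δ) :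
    ∃ q : Stage O, p ≤ q ∧ q.Γ = Γ ∧ q.H = p.H ∪ {g | g ∈ Δ} := by
  subst hΔ
  refine ⟨⟨Γ, Δ + Δ₀, p.H ∪ {g | g ∈ Δ}, V, hprov, fun g hg => ?_, ?_, fun a ha => ?_, ?_,
    fun v hv C hC => ?_⟩, ⟨hΓ, Set.subset_union_left⟩, rfl, rfl⟩
  · rcases Multiset.mem_add.1 hg with hg | hg
    · exact .inr hg
    · exact .inl (p.mem_H g (hp ▸ Multiset.mem_cons_of_mem hg))
  · rintro g (hg | hg)
    · rcases p.mem_or_reduced g hg with h | h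
      · rw [hp, Multiset.mem_cons] at h
        rcases h with rfl | h
        · exact hf.imp_left fun h => Multiset.mem_add.2 (.inl h)
        · exact .inl (Multiset.mem_add.2 (.inr h))
      · exact .inr (h.mono (Finset.coe_subset.2 hΓ) Set.subset_union_left)
    · exact .inl (Multiset.mem_add.2 (.inl hg))
  · by_cases h : a ∈ p.Γ
    · exact (p.atom_labels a h).trans hV
    · exact hatom a ha h
  · rintro g (hg | hg)
    · exact hV (p.label_mem g hg)
    · exact hlabel g hg
  · by_cases h : v ∈ p.V
    · exact .inl (p.gci v h C hC)
    · exact .inr (hgci v hv h C hC)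

/-- An extension adding only formulas with labels already in use. -/
theorem exists_extension_of_labels (p : Stage O) (f : LC) (Δ₀ Δ : Multiset LC)
    (hp : p.Δ = f ::ₘ Δ₀) (hf : f ∈ Δ ∨ Reduced ↑p.Γ (p.H ∪ {g | g ∈ Δ}) f)
    (hprov : ¬ SProvable O p.Γ (Δ + Δ₀)) (hlabel : ∀ g ∈ Δ, g.1 ∈ p.V) :
    ∃ q : Stage O, p ≤ q ∧ q.Γ = p.Γ ∧ q.H = p.H ∪ {g | g ∈ Δ} :=
  p.exists_extension f Δ₀ Δ hp p.Γ _ p.V subset_rfl rfl hf subset_rfl hprov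
    (fun _ h h' => (h' h).elim) hlabel (fun _ h h' => (h' h).elim)

theorem mem_obar {C : Concept} (hC : C ∈ O.gcis) (y : ℕ) : (y, nnfNeg C) ∈ obar O y :=
  Multiset.mem_map.2 ⟨C, hC, rfl⟩

theorem fst_of_mem_obar {y : ℕ} {g : LC} (hg : g ∈ obar O y) : g.1 = y := by
  obtain ⟨C, _, rfl⟩ := Multiset.mem_map.1 hg
  rfl

theorem mem_leΔ {C : Concept} {n : ℕ} {ys : Fin n → ℕ} {g : LC} :
    g ∈ leΔ O C ys ↔ ∃ i, g = (ys i, nnfNeg C) ∨ g ∈ obar O (ys i) := by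
  simp [leΔ, Multiset.mem_sum]

/-- The nonliteral concepts that are consumed by the rule introducing them. -/
def IsConsumed : Concept → Prop
  | .inter _ _ | .union _ _ | .all _ _ | .atMost _ _ _ => True
  | _ => False

theorem exists_reduced (p : Stage O) {x : ℕ} {F : Concept} (hF : (x, F) ∈ p.H)
    (hc : IsConsumed F) : ∃ q : Stage O, p ≤ q ∧ Reduced ↑q.Γ q.H (x, F) := by
  rcases p.mem_or_reduced _ hF with hmem | hred
  swap
  · exact ⟨p, le_rfl, hred⟩
  obtain ⟨Δ₀, hΔ₀⟩ := Multiset.exists_cons_of_mem hmem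
  have hx : x ∈ p.V := p.label_mem _ hF
  have hnp := p.not_provable
  rw [hΔ₀] at hnp
  cases F with
  | inter C D =>
    have key : ∀ E, (E = C ∨ E = D) → ¬ SProvable O p.Γ ((x, E) ::ₘ Δ₀) →
        ∃ q : Stage O, p ≤ q ∧ Reduced ↑q.Γ q.H (x, .inter C D) := by
      intro E hE hprov
      have hred : Reduced ↑p.Γ (p.H ∪ {g | g ∈ ({(x, E)} : Multiset LC)}) (x, .inter C D) := by
        rcases hE with rfl | rfl
        · exact .inl (.inr (Multiset.mem_singleton_self _))
        · exact .inr (.inr (Multiset.mem_singleton_self _))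
      obtain ⟨q, hpq, hΓ, hH⟩ := p.exists_extension_of_labels _ Δ₀ {(x, E)} hΔ₀ (.inr hred)
        (by rwa [Multiset.singleton_add]) (by simpa using hx)
      exact ⟨q, hpq, by rwa [hΓ, hH]⟩
    by_cases hC : SProvable O p.Γ ((x, C) ::ₘ Δ₀)
    · exact key D (.inr rfl) fun hD => hnp (hC.andR hD)
    · exact key C (.inl rfl) hC
  | union C D =>
    have hred : Reduced ↑p.Γ (p.H ∪ {g | g ∈ (x, C) ::ₘ ({(x, D)} : Multiset LC)})
        (x, .union C D) := ⟨.inr (by simp), .inr (by simp)⟩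
    obtain ⟨q, hpq, hΓ, hH⟩ := p.exists_extension_of_labels _ Δ₀ ((x, C) ::ₘ {(x, D)}) hΔ₀
      (.inr hred)
      (by
        rw [Multiset.cons_add, Multiset.singleton_add]
        exact fun ⟨n, hn⟩ => hnp ⟨n + 1, .orR _ _ _ _ _ _ hn⟩)
      (by simpa using hx)
    exact ⟨q, hpq, by rwa [hΓ, hH]⟩
  | all r C =>
    obtain ⟨y, hy⟩ := Infinite.exists_notMem_finset p.V
    have hred : Reduced ↑(insert (SAtom.rel r x y) p.Γ)
        (p.H ∪ {g | g ∈ (y, C) ::ₘ obar O y}) (x, .all r C) :=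
      ⟨y, by simp, .inr (by simp)⟩
    obtain ⟨q, hpq, hΓ, hH⟩ := p.exists_extension _ Δ₀ ((y, C) ::ₘ obar O y) hΔ₀
      (insert (SAtom.rel r x y) p.Γ) ((y, C) ::ₘ (obar O y + Δ₀)) (insert y p.V)
      (Finset.subset_insert _ _) (by rw [Multiset.cons_add]) (.inr hred)
      (Finset.subset_insert _ _)
      (fun ⟨n, hn⟩ => hnp ⟨n + 1, .allR _ _ _ y _ _ _ (p.fresh hy hΔ₀) hn⟩)
      (by
        intro a ha ha'
        obtain rfl := (Finset.mem_insert.1 ha).resolve_right ha'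
        simp [SAtom.labels, Finset.insert_subset_iff, hx])
      (by
        intro g hg
        rcases Multiset.mem_cons.1 hg with rfl | hg
        · simp
        · simp [fst_of_mem_obar hg])
      (by
        intro v hv hv' C hC
        obtain rfl := (Finset.mem_insert.1 hv).resolve_right hv'
        exact Multiset.mem_cons_of_mem (mem_obar hC v))
    exact ⟨q, hpq, by rwa [hΓ, hH]⟩
  | atMost k r C =>
    let ys : Fin (k + 1) → ℕ := fun i => p.V.sup id + 1 + i
    have hinj : Function.Injective ys := fun i j hij => by
      simpa [ys, Fin.ext_iff] using hij
    have hys : ∀ i, ys i ∉ p.V := fun i hi => by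
      have : ys i ≤ p.V.sup id := Finset.le_sup (f := id) hi
      simp only [ys] at this
      omega
    let Γ' := p.Γ ∪ neqSet ys ∪ relSet r x ys
    have hred : Reduced ↑Γ' (p.H ∪ {g | g ∈ leΔ O C ys}) (x, .atMost k r C) := by
      refine ⟨ys, fun i => ?_, fun i j hij => ?_, fun i => .inr (mem_leΔ.2 ⟨i, .inl rfl⟩)⟩
      · exact Finset.mem_union_right _ (Finset.mem_image_of_mem _ (Finset.mem_univ i))
      · exact Finset.mem_union_left _ (Finset.mem_union_right _
          (Finset.mem_image.2 ⟨(i, j), by simpa using hij, rfl⟩))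
    obtain ⟨q, hpq, hΓ, hH⟩ := p.exists_extension _ Δ₀ (leΔ O C ys) hΔ₀ Γ' (leΔ O C ys + Δ₀)
      (p.V ∪ Finset.univ.image ys)
      (Finset.subset_union_left.trans Finset.subset_union_left) rfl (.inr hred)
      Finset.subset_union_left
      (fun ⟨n, hn⟩ => hnp ⟨n + 1, .leR _ _ _ _ _ _ _ ys hinj (fun i => p.fresh (hys i) hΔ₀) hn⟩)
      (by
        intro a ha ha'
        rcases Finset.mem_union.1 ha with ha | ha
        · obtain ⟨i, _, rfl⟩ := Finset.mem_image.1 ((Finset.mem_union.1 ha).resolve_left ha')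
          simp [SAtom.labels, Finset.insert_subset_iff]
        · obtain ⟨i, _, rfl⟩ := Finset.mem_image.1 ha
          simp [SAtom.labels, Finset.insert_subset_iff, hx])
      (by
        intro g hg
        obtain ⟨i, rfl | hg⟩ := mem_leΔ.1 hg
        · simp
        · simp [fst_of_mem_obar hg])
      (by
        intro v hv hv' C hC
        obtain ⟨i, _, rfl⟩ := Finset.mem_image.1 ((Finset.mem_union.1 hv).resolve_left hv')
        exact mem_leΔ.2 ⟨i, .inr (mem_obar hC _)⟩)
    exact ⟨q, hpq, by rwa [hΓ, hH]⟩
  | _ => exact hc.elim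

theorem mem_Δ_of_mem_H (p : Stage O) {x : ℕ} {F : Concept} (hF : (x, F) ∈ p.H)
    (hc : ¬ IsConsumed F) : (x, F) ∈ p.Δ := by
  refine (p.mem_or_reduced _ hF).resolve_right fun h => ?_
  cases F with
  | inter | union | all | atMost => exact hc trivial
  | _ => exact h

theorem exists_ex (p : Stage O) {x y : ℕ} {r : Role} {C : Concept} (hF : (x, .ex r C) ∈ p.H)
    (hxy : pgLang ↑p.Γ O r x y) : ∃ q : Stage O, p ≤ q ∧ (y, C) ∈ q.H := by
  obtain ⟨Δ₀, hΔ₀⟩ := Multiset.exists_cons_of_mem (p.mem_Δ_of_mem_H hF not_false)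
  have hx : x ∈ p.V := p.label_mem _ hF
  have hnp := p.not_provable
  rw [hΔ₀] at hnp
  obtain ⟨q, hpq, -, hH⟩ := p.exists_extension_of_labels _ Δ₀ ((x, .ex r C) ::ₘ {(y, C)}) hΔ₀
    (.inl (by simp))
    (by
      rw [Multiset.cons_add, Multiset.singleton_add]
      exact fun ⟨n, hn⟩ => hnp ⟨n + 1, .exR _ _ _ _ _ _ _ hxy hn⟩)
    (by simpa using ⟨hx, p.pgLang_mem hx hxy⟩)
  exact ⟨q, hpq, by simp [hH]⟩

theorem exists_atLeast (p : Stage O) {x k : ℕ} {r : Role} {C : Concept} {ys : Fin k → ℕ}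
    (hF : (x, .atLeast k r C) ∈ p.H) (hys : ∀ i, pgLang ↑p.Γ O r x (ys i)) :
    ∃ q : Stage O, p ≤ q ∧
      ((∃ i, (ys i, C) ∈ q.H) ∨ ∃ i j, i < j ∧ SAtom.eq (ys i) (ys j) ∈ q.Γ) := by
  obtain ⟨Δ₀, hΔ₀⟩ := Multiset.exists_cons_of_mem (p.mem_Δ_of_mem_H hF not_false)
  have hx : x ∈ p.V := p.label_mem _ hF
  have hyV : ∀ i, ys i ∈ p.V := fun i => p.pgLang_mem hx (hys i)
  have hnp := p.not_provable
  rw [hΔ₀] at hnp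
  by_cases hC : ∀ i, SProvable O p.Γ ((ys i, C) ::ₘ (x, .atLeast k r C) ::ₘ Δ₀)
  · obtain ⟨i, j, hij, hprov⟩ : ∃ i j, i < j ∧
        ¬ SProvable O (insert (SAtom.eq (ys i) (ys j)) p.Γ) ((x, .atLeast k r C) ::ₘ Δ₀) := by
      by_contra! hcon
      exact hnp (.geR hys hC hcon)
    obtain ⟨q, hpq, hΓ, -⟩ := p.exists_extension _ Δ₀ {(x, .atLeast k r C)} hΔ₀
      (insert (SAtom.eq (ys i) (ys j)) p.Γ) _ p.V (Finset.subset_insert _ _)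
      (Multiset.singleton_add _ _).symm (.inl (Multiset.mem_singleton_self _)) subset_rfl hprov
      (by
        intro a ha ha'
        obtain rfl := (Finset.mem_insert.1 ha).resolve_right ha'
        simp [SAtom.labels, Finset.insert_subset_iff, hyV])
      (by simpa using hx) (fun _ h h' => (h' h).elim)
    exact ⟨q, hpq, .inr ⟨i, j, hij, by simp [hΓ]⟩⟩
  · obtain ⟨i, hi⟩ := not_forall.1 hC
    obtain ⟨q, hpq, -, hH⟩ := p.exists_extension_of_labels _ Δ₀
      ((ys i, C) ::ₘ {(x, .atLeast k r C)}) hΔ₀ (.inl (by simp))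
      (by rwa [Multiset.cons_add, Multiset.singleton_add])
      (by simpa using ⟨hyV i, hx⟩)
    exact ⟨q, hpq, .inl ⟨i, by simp [hH]⟩⟩

theorem not_eqRel_of_literal (p : Stage O) {x y A : ℕ} (hx : (x, .atom A) ∈ p.H)
    (hy : (y, .nneg A) ∈ p.H) : ¬ eqRel ↑p.Γ x y := by
  intro hxy
  obtain ⟨Δ₀, hΔ₀⟩ := Multiset.exists_cons_of_mem (p.mem_Δ_of_mem_H hx not_false)
  have hy' := p.mem_Δ_of_mem_H hy not_false
  rw [hΔ₀, Multiset.mem_cons] at hy'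
  obtain ⟨Δ₁, rfl⟩ := Multiset.exists_cons_of_mem (hy'.resolve_left (by simp))
  refine p.not_provable ⟨1, ?_⟩
  rw [hΔ₀]
  refine .subst _ _ _ y _ _ trivial hxy ?_
  rw [Multiset.cons_swap, Multiset.cons_swap (x, Concept.atom A)]
  exact .id ..

theorem not_eqRel_of_neq (p : Stage O) {x y : ℕ} (h : SAtom.neq x y ∈ p.Γ) :
    ¬ eqRel ↑p.Γ x y :=
  fun hxy => p.not_provable ⟨0, .idEq _ _ _ _ _ h hxy⟩

/-- The requirements on a saturated set, indexed by a labeled concept and a tuple of labels. -/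
abbrev Task : Type := LC × Σ k : ℕ, Fin k → ℕ

/-- The requirement applies at the given stage. -/
def Active (O : Ontology) (t : Task) (p : Stage O) : Prop :=
  t.1 ∈ p.H ∧ match t with
  | ((x, .ex r _), ⟨k, ys⟩) => 0 < k ∧ ∀ i, pgLang ↑p.Γ O r x (ys i)
  | ((x, .atLeast n r _), ⟨k, ys⟩) => k = n ∧ ∀ i, pgLang ↑p.Γ O r x (ys i)
  | ((_, F), _) => IsConsumed F

/-- The requirement is met at the given stage. -/
def Met (O : Ontology) (t : Task) (p : Stage O) : Prop :=
  match t with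
  | ((_, .ex _ C), ⟨_, ys⟩) => ∃ i, (ys i, C) ∈ p.H
  | ((_, .atLeast _ _ C), ⟨_, ys⟩) =>
    (∃ i, (ys i, C) ∈ p.H) ∨ ∃ i j, i < j ∧ SAtom.eq (ys i) (ys j) ∈ p.Γ
  | (f, _) => Reduced ↑p.Γ p.H f

theorem active_mono (t : Task) : Monotone (Active O t) := by
  obtain ⟨⟨x, F⟩, k, ys⟩ := t
  rintro p q ⟨hΓ, hH⟩ ⟨h₁, h₂⟩
  refine ⟨hH h₁, ?_⟩
  cases F with
  | ex | atLeast => exact ⟨h₂.1, fun i => pgLang_mono (Finset.coe_subset.2 hΓ) (h₂.2 i)⟩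
  | _ => exact h₂

theorem met_mono (t : Task) : Monotone (Met O t) := by
  obtain ⟨⟨x, F⟩, k, ys⟩ := t
  rintro p q ⟨hΓ, hH⟩ h
  cases F with
  | ex => exact h.imp fun _ h => hH h
  | atLeast =>
    exact Or.imp (fun ⟨i, h⟩ => ⟨i, hH h⟩) (fun ⟨i, j, hij, h⟩ => ⟨i, j, hij, hΓ h⟩) h
  | _ =>
    simp only [Met] at h ⊢
    exact h.mono (Finset.coe_subset.2 hΓ) hH

theorem exists_met (t : Task) (p : Stage O) (h : Active O t p) : ∃ q, p ≤ q ∧ Met O t q := by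
  obtain ⟨⟨x, F⟩, k, ys⟩ := t
  obtain ⟨hF, h⟩ := h
  cases F with
  | ex r C =>
    obtain ⟨q, hpq, hq⟩ := p.exists_ex hF (h.2 ⟨0, h.1⟩)
    exact ⟨q, hpq, _, hq⟩
  | atLeast n r C =>
    obtain ⟨rfl, h⟩ := h
    exact p.exists_atLeast hF h
  | _ => exact p.exists_reduced hF h

theorem exists_isHintikka (p : Stage O) :
    ∃ (Γ : Set SAtom) (H : Set LC) (V : Set ℕ), IsHintikka O Γ H V ∧ p.H ⊆ H := by
  obtain ⟨I, hpI, hI⟩ :=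
    exists_ideal_forall_task p (Active O) (Met O) active_mono met_mono exists_met
  have : Nonempty I := ⟨⟨p, hpI⟩⟩
  have hdir : ∀ q ∈ I, ∀ s ∈ I, ∃ t ∈ I, q ≤ t ∧ s ≤ t := I.directed
  let G : I → Set SAtom := fun q => ↑q.1.Γ
  have hG : Directed (· ⊆ ·) G := fun q s =>
    let ⟨t, ht, hqt, hst⟩ := hdir q q.2 s s.2
    ⟨⟨t, ht⟩, Finset.coe_subset.2 hqt.1, Finset.coe_subset.2 hst.1⟩
  let H : Set LC := {f | ∃ q ∈ I, f ∈ q.H}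
  let V : Set ℕ := {v | ∃ q ∈ I, v ∈ q.V}
  have hΓ_mem : ∀ {a}, a ∈ ⋃ i, G i → ∃ q ∈ I, a ∈ q.Γ := fun h =>
    let ⟨q, hq⟩ := Set.mem_iUnion.1 h
    ⟨q, q.2, hq⟩
  have hΓ_sub : ∀ {q}, q ∈ I → (↑q.Γ : Set SAtom) ⊆ ⋃ i, G i := fun {q} hq =>
    Set.subset_iUnion G ⟨q, hq⟩
  have hH_sub : ∀ {q}, q ∈ I → q.H ⊆ H := fun {q} hq f hf => ⟨q, hq, hf⟩
  have hred : ∀ x F, IsConsumed F → (x, F) ∈ H → Reduced (⋃ i, G i) H (x, F) := by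
    rintro x F hc ⟨q, hq, hF⟩
    obtain ⟨s, hs, h⟩ := hI ((x, F), ⟨0, Fin.elim0⟩) q hq ⟨hF, by
      cases F with
      | inter | union | all | atMost => trivial
      | _ => exact hc.elim⟩
    refine Reduced.mono (hΓ_sub hs) (hH_sub hs) ?_
    cases F with
    | inter | union | all | atMost => exact h
    | _ => exact hc.elim
  have hpath : ∀ {k : ℕ} {x : ℕ} {r : Role} {ys : Fin k → ℕ}, ∀ q ∈ I,
      (∀ i, pgLang (⋃ i, G i) O r x (ys i)) →
      ∃ s ∈ I, q ≤ s ∧ ∀ i, pgLang ↑s.Γ O r x (ys i) := by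
    intro k x r ys q hq h
    choose f hf using fun i => exists_pgLang_of_iUnion hG (h i)
    have hdirI : Directed (· ≤ ·) (fun s : I => s.1) := fun a b =>
      let ⟨t, ht, h₁, h₂⟩ := hdir a a.2 b b.2
      ⟨⟨t, ht⟩, h₁, h₂⟩
    obtain ⟨s, hs⟩ := hdirI.finite_le (Option.elim · ⟨q, hq⟩ f : Option (Fin k) → I)
    exact ⟨s, s.2, hs none, fun i => pgLang_mono (Finset.coe_subset.2 (hs (some i)).1) (hf i)⟩
  refine ⟨⋃ i, G i, H, V, ⟨?_, ?_, fun x C D => hred x (.inter C D) trivial,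
    fun x C D => hred x (.union C D) trivial, ?_, fun x r C => hred x (.all r C) trivial,
    fun x k r C => hred x (.atMost k r C) trivial, ?_, ?_, ?_, ?_⟩, hH_sub hpI⟩
  · rintro x y A ⟨q, hq, hx⟩ ⟨s, hs, hy⟩ hxy
    obtain ⟨u, hu⟩ := exists_eqRel_of_iUnion hG hxy
    obtain ⟨t, ht, hqt, hst⟩ := hdir q hq s hs
    obtain ⟨w, hw, htw, huw⟩ := hdir t ht u u.2
    exact w.not_eqRel_of_literal (htw.2 (hqt.2 hx)) (htw.2 (hst.2 hy))
      (eqRel_mono (Finset.coe_subset.2 huw.1) hu)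
  · intro x y h hxy
    obtain ⟨q, hq, h⟩ := hΓ_mem h
    obtain ⟨u, hu⟩ := exists_eqRel_of_iUnion hG hxy
    obtain ⟨w, hw, hqw, huw⟩ := hdir q hq u u.2
    exact w.not_eqRel_of_neq (hqw.1 h) (eqRel_mono (Finset.coe_subset.2 huw.1) hu)
  · rintro x y r C ⟨q, hq, hx⟩ hxy
    obtain ⟨s, hs, hqs, hsy⟩ := hpath (ys := fun _ : Fin 1 => y) q hq fun _ => hxy
    obtain ⟨t, ht, i, hi⟩ := hI ((x, .ex r C), ⟨1, fun _ => y⟩) s hs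
      ⟨hqs.2 hx, Nat.one_pos, hsy⟩
    exact ⟨t, ht, hi⟩
  · rintro x k r C ys ⟨q, hq, hx⟩ hys
    obtain ⟨s, hs, hqs, hsy⟩ := hpath q hq hys
    obtain ⟨t, ht, h⟩ := hI ((x, .atLeast k r C), ⟨k, ys⟩) s hs ⟨hqs.2 hx, rfl, hsy⟩
    exact h.imp (fun ⟨i, hi⟩ => ⟨i, t, ht, hi⟩) fun ⟨i, j, hij, h⟩ => ⟨i, j, hij, hΓ_sub ht h⟩
  · intro a ha z hz
    obtain ⟨q, hq, ha⟩ := hΓ_mem ha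
    exact ⟨q, hq, q.atom_labels a ha hz⟩
  · rintro f ⟨q, hq, hf⟩
    exact ⟨q, hq, q.label_mem f hf⟩
  · rintro v ⟨q, hq, hv⟩ C hC
    exact ⟨q, hq, q.gci v hv C hC⟩

end Stage

/-- Completeness: if ⊨_O ∅ ⊢ x : C, then S(O) ⊩ ∅ ⊢ x : O̅, x : C. -/
theorem completeness (O : Ontology) (C : Concept) (x : ℕ)
    (h : ValidSeq O ∅ {(x, C)}) :
    SProvable O ∅ ((x, C) ::ₘ obar O x) := by
  by_contra hnp
  let p : Stage O :=
    { Γ := ∅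
      Δ := (x, C) ::ₘ obar O x
      H := {f | f ∈ (x, C) ::ₘ obar O x}
      V := {x}
      not_provable := hnp
      mem_H := fun _ hf => hf
      mem_or_reduced := fun _ hf => .inl hf
      atom_labels := by simp
      label_mem := by
        intro f hf
        rcases Multiset.mem_cons.1 hf with rfl | hf
        · simp
        · simp [Stage.fst_of_mem_obar hf]
      gci := by
        intro v hv D hD
        obtain rfl := Finset.mem_singleton.1 hv
        exact Multiset.mem_cons_of_mem (Stage.mem_obar hD v) }
  obtain ⟨Γ, H, V, hH, hp⟩ := p.exists_isHintikka
  exact hH.not_validSeq (hp (Multiset.mem_cons_self _ _)) h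

end RIQ
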